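/- arXiv:1207.0773 — 2 statements merged into one kernel-verified Lean document; each statement's English description precedes it below -/
import Mathlib

section
/- There exists a constant c > 0 such that the following holds for all integers n ≥ 2 and k ≥ 2. Let x : Fin (k^n) → ([k]^n) be any surjective sequence of queries (a deterministic non-adaptive strategy that eventually asks every possible query). For a code z, let T(z) be the least s ≥ 1 such that the answers eq(z, x^1), …, eq(z, x^s) uniquely determine z, i.e., such that every code z' with eq(z', x^j) = eq(z, x^j) for all j ≤ s equals z. Then (1/k^n) · Σ_{z ∈ [k]^n} T(z) ≥ c · n · log k / max{log(n/k), 1} (natural logarithm). In words: any deterministic non-adaptive strategy for black-peg Mastermind needs an expected number of Ω(n log k / max{log(n/k), 1}) queries to determine a secret code drawn uniformly at random from [k]^n. -/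
/-- Black-peg answer in Mastermind: number of positions where the two codes agree. -/
def mmEq {n k : ℕ} (z x : Fin n → Fin k) : ℕ :=
  (Finset.univ.filter fun i => z i = x i).card

open Finset in
theorem sum_range_one_div_mul_succ (m : ℕ) :
    ∑ a ∈ range m, (1 : ℝ) / ((a + 1) * (a + 2)) = 1 - 1 / (m + 1) := by
  induction m with
  | zero => simp
  | succ m ih =>
    rw [sum_range_succ, ih]
    push_cast
    field_simp
    ring

theorem mmEq_le {n k : ℕ} (z x : Fin n → Fin k) : mmEq z x ≤ n := by
  unfold mmEq
  simpa using Finset.card_filter_le (Finset.univ : Finset (Fin n)) fun i => z i = x i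

/-- The mean of the black-peg answer to a fixed query is `n / k`. -/
theorem sum_mmEq {n k : ℕ} (x : Fin n → Fin k) :
    (∑ z : Fin n → Fin k, mmEq z x) * k = n * k ^ n := by
  have h (i : Fin n) : (∑ z : Fin n → Fin k, if z i = x i then 1 else 0) * k = k ^ n := by
    have h_pi : (Finset.univ.filter fun z : Fin n → Fin k => z i = x i) =
        Fintype.piFinset fun j => if j = i then {x i} else Finset.univ := by
      ext z
      simp only [Finset.mem_filter, Finset.mem_univ, true_and, Fintype.mem_piFinset]
      constructor
      · intro hz j
        by_cases hj : j = i
        · subst hj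
          simp [hz]
        · simp [hj]
      · intro hz
        simpa using hz i
    have h_card (j : Fin n) : (if j = i then {x i} else Finset.univ : Finset (Fin k)).card =
        if j = i then 1 else k := by
      split_ifs <;> simp
    have hn : n = n - 1 + 1 := by have := i.isLt; omega
    rw [Finset.sum_boole, h_pi, Fintype.card_piFinset]
    simp only [h_card]
    rw [Finset.prod_ite]
    simp only [Finset.prod_const_one, one_mul, Finset.prod_const]
    rw [Finset.filter_ne', Finset.card_erase_of_mem (Finset.mem_univ i), Finset.card_univ,
      Fintype.card_fin, Nat.cast_id, ← pow_succ, ← hn]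
  simp only [mmEq, Finset.card_filter]
  rw [Finset.sum_comm, Finset.sum_mul, Finset.sum_congr rfl fun i _ => h i]
  simp

theorem sum_log_mmEq_add_two_le {n k : ℕ} (hk : 0 < k) (x : Fin n → Fin k) :
    ∑ z : Fin n → Fin k, Real.log (mmEq z x + 2) ≤
      (k : ℝ) ^ n * Real.log (n / k + 2) := by
  set m : ℝ := n / k with hm
  have hk' : (0 : ℝ) < k := by exact_mod_cast hk
  have hm2 : 0 < m + 2 := by positivity
  have h_tangent (z : Fin n → Fin k) :
      Real.log (mmEq z x + 2) ≤ Real.log (m + 2) + (mmEq z x - m) / (m + 2) := by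
    have hz : (0 : ℝ) < mmEq z x + 2 := by positivity
    have h := Real.log_le_sub_one_of_pos (div_pos hz hm2)
    rw [Real.log_div hz.ne' hm2.ne'] at h
    have e : ((mmEq z x : ℝ) + 2) / (m + 2) - 1 = (mmEq z x - m) / (m + 2) := by
      field_simp
      ring
    linarith
  have h_mean : ∑ z : Fin n → Fin k, ((mmEq z x : ℝ) - m) = 0 := by
    have h : (∑ z : Fin n → Fin k, (mmEq z x : ℝ)) * k = n * (k : ℝ) ^ n := by
      exact_mod_cast sum_mmEq x
    rw [Finset.sum_sub_distrib, (eq_div_iff hk'.ne').2 h]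
    simp [hm]
    ring
  calc ∑ z : Fin n → Fin k, Real.log (mmEq z x + 2)
      ≤ ∑ z : Fin n → Fin k, (Real.log (m + 2) + (mmEq z x - m) / (m + 2)) :=
        Finset.sum_le_sum fun z _ => h_tangent z
    _ = (k : ℝ) ^ n * Real.log (m + 2) := by
        rw [Finset.sum_add_distrib, ← Finset.sum_div, h_mean]
        simp

/-- Gibbs' inequality against the uniform distribution on a finite set. -/
theorem card_mul_log_card_le {α : Type*} (A : Finset α) (Q : α → ℝ) (hQ : ∀ z ∈ A, 0 < Q z)
    (hsum : ∑ z ∈ A, Q z ≤ 1) :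
    (A.card : ℝ) * Real.log A.card ≤ ∑ z ∈ A, -Real.log (Q z) := by
  have h : ∀ z ∈ A, Real.log A.card + Real.log (Q z) ≤ A.card * Q z - 1 := by
    intro z hz
    have hA : (0 : ℝ) < A.card := by exact_mod_cast Finset.card_pos.2 ⟨z, hz⟩
    rw [← Real.log_mul hA.ne' (hQ z hz).ne']
    exact Real.log_le_sub_one_of_pos (mul_pos hA (hQ z hz))
  have hs := Finset.sum_le_sum h
  rw [Finset.sum_add_distrib, Finset.sum_sub_distrib, ← Finset.mul_sum] at hs
  simp only [Finset.sum_const, nsmul_eq_mul, mul_one] at hs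
  rw [Finset.sum_neg_distrib]
  have := mul_le_mul_of_nonneg_left hsum (Nat.cast_nonneg (α := ℝ) A.card)
  linarith

/-- If the answers to the queries `x` distinguish the codes in `A`, then `A` is not too large. -/
theorem card_mul_log_card_le_of_injOn {n k : ℕ} (hk : 0 < k) {ι : Type*} [Fintype ι]
    (x : ι → Fin n → Fin k) (A : Finset (Fin n → Fin k))
    (hA : Set.InjOn (fun z j => mmEq z (x j)) (A : Set (Fin n → Fin k))) :
    (A.card : ℝ) * Real.log A.card ≤
      Fintype.card ι * ((k : ℝ) ^ n * (2 * Real.log (n / k + 2))) := by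
  classical
  let q : ℕ → ℝ := fun a => 1 / ((a + 1) * (a + 2))
  have hq (a : ℕ) : 0 < q a := by positivity
  have h_log (a : ℕ) : 0 ≤ -Real.log (q a) ∧ -Real.log (q a) ≤ 2 * Real.log (a + 2) := by
    have h1 : (1 : ℝ) ≤ a + 1 := by simp
    have h2 : Real.log (q a) = -(Real.log (a + 1) + Real.log (a + 2)) := by
      rw [← Real.log_mul (by positivity) (by positivity), ← Real.log_inv, ← one_div]
    have h3 : Real.log ((a : ℝ) + 1) ≤ Real.log (a + 2) :=
      Real.log_le_log (by positivity) (by linarith)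
    have h4 := Real.log_nonneg h1
    constructor <;> linarith
  have h_kraft : ∑ z ∈ A, ∏ j, q (mmEq z (x j)) ≤ 1 := by
    calc ∑ z ∈ A, ∏ j, q (mmEq z (x j))
        = ∑ y ∈ A.image fun z j => mmEq z (x j), ∏ j, q (y j) := by
          rw [Finset.sum_image hA]
      _ ≤ ∑ y ∈ Fintype.piFinset fun _ : ι => Finset.range (n + 1), ∏ j, q (y j) := by
          refine Finset.sum_le_sum_of_subset_of_nonneg ?_ fun y _ _ =>
            Finset.prod_nonneg fun j _ => (hq _).le
          intro y hy
          obtain ⟨z, -, rfl⟩ := Finset.mem_image.1 hy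
          simp [Fintype.mem_piFinset, mmEq_le]
      _ = ∏ _j : ι, ∑ a ∈ Finset.range (n + 1), q a :=
          (Finset.prod_univ_sum (fun _ => Finset.range (n + 1)) fun _ a => q a).symm
      _ ≤ 1 := by
          refine Finset.prod_le_one (fun j _ => Finset.sum_nonneg fun a _ => (hq a).le) ?_
          intro j _
          rw [sum_range_one_div_mul_succ]
          have : (0 : ℝ) ≤ 1 / (((n + 1 : ℕ) : ℝ) + 1) := by positivity
          linarith
  calc (A.card : ℝ) * Real.log A.card
      ≤ ∑ z ∈ A, -Real.log (∏ j, q (mmEq z (x j))) :=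
        card_mul_log_card_le A _ (fun z _ => Finset.prod_pos fun j _ => hq _) h_kraft
    _ = ∑ z ∈ A, ∑ j, -Real.log (q (mmEq z (x j))) := by
        refine Finset.sum_congr rfl fun z _ => ?_
        rw [Real.log_prod fun j _ => (hq _).ne', Finset.sum_neg_distrib]
    _ ≤ ∑ z, ∑ j, -Real.log (q (mmEq z (x j))) :=
        Finset.sum_le_sum_of_subset_of_nonneg (Finset.subset_univ _) fun z _ _ =>
          Finset.sum_nonneg fun j _ => (h_log _).1
    _ = ∑ j, ∑ z, -Real.log (q (mmEq z (x j))) := Finset.sum_comm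
    _ ≤ ∑ _j : ι, (k : ℝ) ^ n * (2 * Real.log (n / k + 2)) := by
        refine Finset.sum_le_sum fun j _ => ?_
        calc ∑ z, -Real.log (q (mmEq z (x j)))
            ≤ ∑ z, 2 * Real.log (mmEq z (x j) + 2) := Finset.sum_le_sum fun z _ => (h_log _).2
          _ = 2 * ∑ z, Real.log (mmEq z (x j) + 2) := by rw [Finset.mul_sum]
          _ ≤ (k : ℝ) ^ n * (2 * Real.log (n / k + 2)) := by
              have := sum_log_mmEq_add_two_le hk (x j)
              linarith
    _ = _ := by simp

theorem log_add_two_le_two_mul_max {m : ℝ} (hm : 0 < m) :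
    Real.log (m + 2) ≤ 2 * max (Real.log m) 1 := by
  rcases le_total m 2 with h | h
  · have h4 : Real.log (m + 2) ≤ Real.log 4 := Real.log_le_log (by linarith) (by linarith)
    have h2 : Real.log 4 = 2 * Real.log 2 := by
      rw [show (4 : ℝ) = 2 ^ 2 by norm_num, Real.log_pow]
      norm_num
    have := Real.log_two_lt_d9
    have := le_max_right (Real.log m) 1
    linarith
  · have h2 : Real.log (m + 2) ≤ Real.log (m ^ 2) := Real.log_le_log (by linarith) (by nlinarith)
    rw [Real.log_pow] at h2
    have := le_max_left (Real.log m) 1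
    push_cast at h2
    linarith

/-- Markov's inequality: at least half of the values are at most twice the mean. -/
theorem card_le_two_mul_card_filter_le_floor {α : Type*} [Fintype α] (T : α → ℕ) (t : ℝ)
    (ht : 0 < t) (hT : ∑ z, (T z : ℝ) ≤ Fintype.card α * t) :
    (Fintype.card α : ℝ) ≤ 2 * (Finset.univ.filter fun z => T z ≤ ⌊2 * t⌋₊).card := by
  have h_split := Finset.card_filter_add_card_filter_not (s := (Finset.univ : Finset α))
    fun z => T z ≤ ⌊2 * t⌋₊
  rw [Finset.card_univ] at h_split
  have h_split' := congrArg (Nat.cast (R := ℝ)) h_split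
  push_cast at h_split'
  have h_large : ((Finset.univ.filter fun z => ¬T z ≤ ⌊2 * t⌋₊).card : ℝ) * (2 * t) ≤
      Fintype.card α * t := by
    rw [← nsmul_eq_mul]
    refine (Finset.card_nsmul_le_sum _ (fun z => (T z : ℝ)) _ fun z hz => ?_).trans <|
      (Finset.sum_le_sum_of_subset_of_nonneg (Finset.subset_univ _)
        fun z _ _ => Nat.cast_nonneg _).trans hT
    exact (Nat.lt_of_floor_lt (not_le.1 (Finset.mem_filter.1 hz).2)).le
  have := le_of_mul_le_mul_right (by linarith :
    (2 * (Finset.univ.filter fun z => ¬T z ≤ ⌊2 * t⌋₊).card : ℝ) * t ≤ Fintype.card α * t) ht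
  linarith


/-- Any deterministic non-adaptive strategy for black-peg Mastermind needs an
expected number of `Ω(n log k / max{log(n/k), 1})` queries to determine a secret
code drawn uniformly at random from `[k]^n`. -/
theorem stmt_1 :
    ∃ c : ℝ, 0 < c ∧
      ∀ n k : ℕ, 2 ≤ n → 2 ≤ k →
        ∀ x : Fin (k ^ n) → (Fin n → Fin k), Function.Surjective x →
          ∀ T : (Fin n → Fin k) → ℕ,
            (∀ z : Fin n → Fin k,
              IsLeast {s : ℕ | 1 ≤ s ∧
                ∀ z' : Fin n → Fin k,
                  (∀ j : Fin (k ^ n), (j : ℕ) < s → mmEq z' (x j) = mmEq z (x j)) →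
                    z' = z} (T z)) →
            (1 / (k : ℝ) ^ n) * ∑ z : Fin n → Fin k, (T z : ℝ) ≥
              c * n * Real.log k / max (Real.log ((n : ℝ) / k)) 1 := by
  refine ⟨1 / 32, by norm_num, fun n k hn hk x _ T hT => ?_⟩
  have hk0 : (0 : ℝ) < k := by exact_mod_cast (by omega : 0 < k)
  have hn0 : (0 : ℝ) < n := by exact_mod_cast (by omega : 0 < n)
  have hK4 : (4 : ℝ) ≤ (k : ℝ) ^ n := by
    have h2k : (2 : ℝ) ≤ k := by exact_mod_cast hk
    calc (4 : ℝ) = 2 ^ 2 := by norm_num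
      _ ≤ (k : ℝ) ^ 2 := by gcongr
      _ ≤ (k : ℝ) ^ n := pow_le_pow_right₀ (by linarith) hn
  have hK0 : (0 : ℝ) < (k : ℝ) ^ n := by linarith
  have h_card : (Fintype.card (Fin n → Fin k) : ℝ) = (k : ℝ) ^ n := by simp
  set M := max (Real.log ((n : ℝ) / k)) 1
  have hM : 1 ≤ M := le_max_right _ _
  set t := (1 / (k : ℝ) ^ n) * ∑ z : Fin n → Fin k, (T z : ℝ) with ht_def
  have h_sum : ∑ z : Fin n → Fin k, (T z : ℝ) = (k : ℝ) ^ n * t := by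
    rw [ht_def]
    field_simp
  have ht : 0 < t := by
    have : (0 : ℝ) < ∑ z : Fin n → Fin k, (T z : ℝ) :=
      Finset.sum_pos (fun z _ => by exact_mod_cast (hT z).1.1)
        ⟨fun _ => ⟨0, by omega⟩, Finset.mem_univ _⟩
    positivity
  set s := ⌊2 * t⌋₊
  have hs : (s : ℝ) ≤ 2 * t := Nat.floor_le (by positivity)
  set A : Finset (Fin n → Fin k) := Finset.univ.filter fun z => T z ≤ s
  have hA : (k : ℝ) ^ n ≤ 2 * A.card := by
    rw [← h_card]
    exact card_le_two_mul_card_filter_le_floor T t ht (by rw [h_card, h_sum])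
  have h_inj : Set.InjOn (fun z (j : {j : Fin (k ^ n) // (j : ℕ) < s}) => mmEq z (x j))
      (A : Set (Fin n → Fin k)) := by
    intro z' _ z hz h
    have hz : T z ≤ s := by simpa [A] using hz
    exact (hT z).1.2 z' fun j hj => congrFun h ⟨j, hj.trans_le hz⟩
  have h_queries : (Fintype.card {j : Fin (k ^ n) // (j : ℕ) < s} : ℝ) ≤ s := by
    have := Fintype.card_le_of_injective
      (fun j : {j : Fin (k ^ n) // (j : ℕ) < s} => (⟨j.1, j.2⟩ : Fin s))
      fun a b h => Subtype.ext (Fin.ext (by simpa using h))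
    rw [Fintype.card_fin] at this
    exact_mod_cast this
  have h_log_A : n * Real.log k / 2 ≤ Real.log A.card := by
    have h1 : Real.log ((k : ℝ) ^ n) ≤ Real.log ((A.card : ℝ) ^ 2) :=
      Real.log_le_log hK0 (by nlinarith)
    rw [Real.log_pow, Real.log_pow] at h1
    push_cast at h1
    linarith
  have h_log_k : 0 ≤ n * Real.log k := by positivity
  have h_upper : (A.card : ℝ) * Real.log A.card ≤ 2 * t * ((k : ℝ) ^ n * (2 * (2 * M))) := by
    refine (card_mul_log_card_le_of_injOn (by omega) _ A h_inj).trans ?_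
    have h_max := log_add_two_le_two_mul_max (div_pos hn0 hk0)
    have h_pos : 0 ≤ Real.log ((n : ℝ) / k + 2) :=
      Real.log_nonneg (by have := div_pos hn0 hk0; linarith)
    gcongr
    · exact h_queries.trans hs
  have h_lower : (k : ℝ) ^ n / 2 * (n * Real.log k / 2) ≤ A.card * Real.log A.card :=
    mul_le_mul (by linarith only [hA]) h_log_A (by positivity) (Nat.cast_nonneg _)
  have h_final : n * Real.log k ≤ 32 * t * M := by
    refine le_of_mul_le_mul_left ?_ hK0
    calc (k : ℝ) ^ n * (n * Real.log k)
        = 4 * ((k : ℝ) ^ n / 2 * (n * Real.log k / 2)) := by ring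
      _ ≤ 4 * (2 * t * ((k : ℝ) ^ n * (2 * (2 * M)))) :=
          mul_le_mul_of_nonneg_left (h_lower.trans h_upper) (by norm_num)
      _ = (k : ℝ) ^ n * (32 * t * M) := by ring
  rw [ge_iff_le, div_le_iff₀ (by linarith)]
  linarith
end

section
/- There exist n₀ ∈ ℕ and a constant C > 0 such that for every n ≥ n₀ and every k with 2 ≤ k ≤ n the following holds with N := ⌈C · n · log k / max{log(n/k), 1}⌉: the number of N-tuples of queries (x^1, …, x^N) ∈ ([k]^n)^N for which the map z ↦ (eq(z, x^1), …, eq(z, x^N)) is NOT injective on [k]^n is at most k^{n·N} / n. In words: a set of N independent uniformly random queries identifies every possible secret code with probability at least 1 − 1/n. -/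
theorem Nat.two_mul_add_one_mul_centralBinom_sq_le (j : ℕ) :
    (2 * j + 1) * j.centralBinom ^ 2 ≤ 16 ^ j := by
  induction j with
  | zero => simp
  | succ j ih =>
    have h := Nat.succ_mul_centralBinom_succ j
    have hpos : 0 < (j + 1) ^ 2 := by positivity
    refine Nat.le_of_mul_le_mul_left ?_ hpos
    calc (j + 1) ^ 2 * ((2 * (j + 1) + 1) * (j + 1).centralBinom ^ 2)
        = (2 * j + 3) * ((j + 1) * (j + 1).centralBinom) ^ 2 := by ring
      _ = (2 * j + 3) * (2 * j + 1) * 4 * ((2 * j + 1) * j.centralBinom ^ 2) := by rw [h]; ring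
      _ ≤ (2 * j + 3) * (2 * j + 1) * 4 * 16 ^ j := by gcongr
      _ ≤ (4 * (j + 1) ^ 2) * 4 * 16 ^ j :=
        Nat.mul_le_mul_right _ (Nat.mul_le_mul_right _ (by nlinarith))
      _ = (j + 1) ^ 2 * 16 ^ (j + 1) := by ring

open Polynomial in
theorem coeff_one_add_X_sq_pow_self_sq_le (m : ℕ) :
    ((m : ℝ) + 1) * (((1 + X ^ 2 : ℝ[X]) ^ m).coeff m) ^ 2 ≤ 4 ^ m := by
  have h : (1 + X ^ 2 : ℝ[X]) ^ m = expand ℝ 2 ((1 + X) ^ m) := by simp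
  rw [h, coeff_expand two_pos]
  split_ifs with hm
  · obtain ⟨j, rfl⟩ := hm
    have := Nat.two_mul_add_one_mul_centralBinom_sq_le j
    rw [Nat.mul_div_cancel_left _ two_pos, coeff_one_add_X_pow, ← Nat.centralBinom, pow_mul]
    norm_num
    exact_mod_cast this
  · simp

theorem sub_mul_add_two_pow_le {a : ℝ} (ha : 0 ≤ a) (d : ℕ) :
    (a - d) * (a + 2) ^ (d + 1) ≤ (a + 2 + d) * a ^ (d + 1) := by
  induction d with
  | zero => simp; linarith
  | succ d ih =>
    push_cast
    by_cases h : a ≤ d + 1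
    · have h1 : (a - (d + 1)) * (a + 2) ^ (d + 1 + 1) ≤ 0 :=
        mul_nonpos_of_nonpos_of_nonneg (by linarith) (by positivity)
      have h2 : 0 ≤ (a + 2 + (d + 1)) * a ^ (d + 1 + 1) := by positivity
      linarith
    · push Not at h
      have hpos : 0 < a + 2 + d := by positivity
      refine le_of_mul_le_mul_left ?_ hpos
      have key : (a + 2 + d) * ((a - (d + 1)) * (a + 2)) ≤ (a + 3 + d) * a * (a - d) := by
        nlinarith [(Nat.cast_nonneg d : (0 : ℝ) ≤ d)]
      calc (a + 2 + d) * ((a - (d + 1)) * (a + 2) ^ (d + 1 + 1))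
          = (a + 2 + d) * ((a - (d + 1)) * (a + 2)) * (a + 2) ^ (d + 1) := by ring
        _ ≤ (a + 3 + d) * a * (a - d) * (a + 2) ^ (d + 1) := by gcongr
        _ = (a + 3 + d) * a * ((a - d) * (a + 2) ^ (d + 1)) := by ring
        _ ≤ (a + 3 + d) * a * ((a + 2 + d) * a ^ (d + 1)) := by gcongr
        _ = _ := by ring

theorem sum_choose_mul_div_succ (a b : ℝ) (d : ℕ) :
    b * (d + 1) * ∑ m ∈ Finset.range (d + 1), b ^ m * a ^ (d - m) * d.choose m / (m + 1) =
      (b + a) ^ (d + 1) - a ^ (d + 1) := by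
  rw [add_pow b a (d + 1), Finset.sum_range_succ' _ (d + 1)]
  simp only [pow_zero, Nat.sub_zero, Nat.choose_zero_right, Nat.cast_one, one_mul, mul_one,
    add_sub_cancel_right, Nat.add_sub_add_right, Finset.mul_sum]
  refine Finset.sum_congr rfl fun m _ => ?_
  have h : ((d : ℝ) + 1) * d.choose m = (d + 1).choose (m + 1) * (m + 1) := by
    exact_mod_cast Nat.add_one_mul_choose_eq d m
  field_simp
  linear_combination (b ^ (m + 1) * a ^ (d - m)) * h

open Polynomial in
/-- The middle coefficient of `(1 + X² + aX) ^ d` is at most `(a + 2) ^ d / √(1 + d / (a + 2))`. -/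
theorem coeff_trinomial_pow_sq_le {a : ℝ} (ha : 0 ≤ a) (d : ℕ) :
    (((1 + X ^ 2 + C a * X : ℝ[X]) ^ d).coeff d) ^ 2 * (a + 2 + d) ≤ (a + 2) ^ (2 * d + 1) := by
  set w : ℕ → ℝ := fun m => ((1 + X ^ 2 : ℝ[X]) ^ m).coeff m / 2 ^ m with hw
  set b : ℕ → ℝ := fun m => 2 ^ m * a ^ (d - m) * d.choose m with hb
  have hb0 : ∀ m, 0 ≤ b m := fun m => by positivity
  have hw2 : ∀ m, (w m) ^ 2 ≤ 1 / (m + 1) := fun m => by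
    have := coeff_one_add_X_sq_pow_self_sq_le m
    rw [le_div_iff₀ (by positivity), hw]
    simp only [div_pow]
    rw [div_mul_eq_mul_div, div_le_one (by positivity), ← pow_mul, mul_comm m 2, pow_mul]
    norm_num
    linarith
  have hc : ((1 + X ^ 2 + C a * X : ℝ[X]) ^ d).coeff d =
      ∑ m ∈ Finset.range (d + 1), b m * w m := by
    rw [add_pow, finsetSum_coeff]
    refine Finset.sum_congr rfl fun m hm => ?_
    have hm' : m ≤ d := Nat.lt_succ_iff.mp (Finset.mem_range.mp hm)
    have e : (1 + X ^ 2 : ℝ[X]) ^ m * (C a * X) ^ (d - m) * (d.choose m : ℝ[X]) =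
        C (a ^ (d - m) * d.choose m) * ((1 + X ^ 2) ^ m * X ^ (d - m)) := by
      simp only [mul_pow, C_mul, C_pow, map_natCast]; ring
    rw [e, coeff_C_mul, coeff_mul_X_pow', if_pos (Nat.sub_le d m), Nat.sub_sub_self hm']
    simp only [hw, hb]
    field_simp
  have hsb : ∑ m ∈ Finset.range (d + 1), b m = (a + 2) ^ d := by
    rw [add_comm a 2, add_pow]
  have hcs : (∑ m ∈ Finset.range (d + 1), b m * w m) ^ 2 ≤
      (∑ m ∈ Finset.range (d + 1), b m) * ∑ m ∈ Finset.range (d + 1), b m * (w m) ^ 2 :=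
    Finset.sum_sq_le_sum_mul_sum_of_sq_le_mul _ (fun m _ => hb0 m)
      (fun m _ => mul_nonneg (hb0 m) (sq_nonneg _)) (fun m _ => (by ring : _ = _).le)
  have hE : ∑ m ∈ Finset.range (d + 1), b m * (w m) ^ 2 ≤
      ∑ m ∈ Finset.range (d + 1), b m / (m + 1) := by
    refine Finset.sum_le_sum fun m _ => ?_
    rw [div_eq_mul_one_div]
    exact mul_le_mul_of_nonneg_left (hw2 m) (hb0 m)
  have hS := sum_choose_mul_div_succ a 2 d
  have hF := sub_mul_add_two_pow_le ha d
  set E := ∑ m ∈ Finset.range (d + 1), b m / (m + 1) with hEdef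
  have hE2 : E * (a + 2 + d) ≤ (a + 2) ^ (d + 1) := by
    have h1 : 2 * ((d : ℝ) + 1) * E = (2 + a) ^ (d + 1) - a ^ (d + 1) := hS
    rw [add_comm 2 a] at h1
    have h2 : (0 : ℝ) < 2 * (d + 1) := by positivity
    refine le_of_mul_le_mul_left ?_ h2
    calc 2 * ((d : ℝ) + 1) * (E * (a + 2 + d))
        = (2 * ((d : ℝ) + 1) * E) * (a + 2 + d) := by ring
      _ = ((a + 2) ^ (d + 1) - a ^ (d + 1)) * (a + 2 + d) := by rw [h1]
      _ ≤ _ := by linarith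
  rw [hc]
  calc _ ≤ ((a + 2) ^ d * E) * (a + 2 + d) := by
        gcongr
        refine hcs.trans ?_
        rw [hsb]
        gcongr
    _ = (a + 2) ^ d * (E * (a + 2 + d)) := by ring
    _ ≤ (a + 2) ^ d * (a + 2) ^ (d + 1) := by gcongr
    _ = _ := by ring

open Polynomial in
/-- The number of queries giving equal answers to two codes at Hamming distance `d`, as a middle
trinomial coefficient. -/
theorem card_mmEq_eq_eq_coeff {n k : ℕ} (z z' : Fin n → Fin k) :
    ((Finset.univ.filter fun x : Fin n → Fin k => mmEq z x = mmEq z' x).card : ℝ) =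
      k ^ (n - (Finset.univ.filter fun i => z i ≠ z' i).card) *
        ((1 + X ^ 2 + C ((k : ℝ) - 2) * X : ℝ[X]) ^
          (Finset.univ.filter fun i => z i ≠ z' i).card).coeff
          (Finset.univ.filter fun i => z i ≠ z' i).card := by
  set S := Finset.univ.filter fun i => z i ≠ z' i with hS
  set e : Fin n → Fin k → ℕ := fun i c =>
    (if z i = c then 1 else 0) + (if z' i = c then 0 else 1) with he
  have hsum : ∀ x : Fin n → Fin k, mmEq z x = mmEq z' x ↔ n = ∑ i, e i (x i) := fun x => by
    have h1 : ∑ i, (if z i = x i then 1 else 0) = mmEq z x := by simp [mmEq]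
    have h2 : ∑ i, (if z' i = x i then 0 else 1) + mmEq z' x = n := by
      rw [mmEq, Finset.card_filter, ← Finset.sum_add_distrib]
      trans ∑ _i : Fin n, 1
      · exact Finset.sum_congr rfl fun i _ => by split_ifs <;> rfl
      · simp
    simp only [he, Finset.sum_add_distrib, h1]
    omega
  have hfac : ∀ i, ∑ c, (X : ℝ[X]) ^ e i c =
      if z i ≠ z' i then 1 + X ^ 2 + C ((k : ℝ) - 2) * X else C (k : ℝ) * X := fun i => by
    split_ifs with h
    · have : ∀ c, (X : ℝ[X]) ^ e i c =
          X + (if z i = c then X ^ 2 - X else 0) + (if z' i = c then 1 - X else 0) := fun c => by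
        simp only [he]
        split_ifs with h1 h2 h2
        · exact absurd (h1.trans h2.symm) h
        · simp
        · simp
        · simp
      simp only [this, Finset.sum_add_distrib, Finset.sum_ite_eq, Finset.mem_univ, if_true]
      simp only [Finset.sum_const, Finset.card_univ, Fintype.card_fin, nsmul_eq_mul, C_sub,
        map_natCast, map_ofNat]
      ring
    · push Not at h
      have : ∀ c, (X : ℝ[X]) ^ e i c = X := fun c => by
        simp only [he, h]; split_ifs <;> simp
      simp [this]
  have hprod : ∏ i, ∑ c, (X : ℝ[X]) ^ e i c = ∑ x : Fin n → Fin k, X ^ ∑ i, e i (x i) := by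
    rw [Finset.prod_univ_sum, Fintype.piFinset_univ]
    simp only [Finset.prod_pow_eq_pow_sum]
  have hcount : ((Finset.univ.filter fun x : Fin n → Fin k => mmEq z x = mmEq z' x).card : ℝ) =
      (∏ i, ∑ c, (X : ℝ[X]) ^ e i c).coeff n := by
    rw [hprod, finsetSum_coeff]
    simp only [coeff_X_pow, ← hsum]
    simp
  have hle : S.card ≤ n := by simpa using Finset.card_le_univ S
  have hcompl : (Finset.univ.filter fun i => ¬ z i ≠ z' i).card = n - S.card := by
    refine Nat.eq_sub_of_add_eq' ?_
    rw [hS, Finset.card_filter_add_card_filter_not, Finset.card_univ, Fintype.card_fin]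
  rw [hcount, Finset.prod_congr rfl fun i _ => hfac i, Finset.prod_ite, Finset.prod_const,
    Finset.prod_const, hcompl, ← hS, mul_pow, ← C_pow,
    mul_comm, mul_assoc, coeff_C_mul, mul_comm (X ^ _)]
  rw [coeff_mul_X_pow', if_pos (Nat.sub_le _ _), Nat.sub_sub_self hle]

theorem card_mmEq_eq_sq_le {n k : ℕ} (hk : 2 ≤ k) (z z' : Fin n → Fin k) :
    ((Finset.univ.filter fun x : Fin n → Fin k => mmEq z x = mmEq z' x).card : ℝ) ^ 2 *
      (1 + (Finset.univ.filter fun i => z i ≠ z' i).card / k) ≤ (k : ℝ) ^ (2 * n) := by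
  rw [card_mmEq_eq_eq_coeff]
  set d := (Finset.univ.filter fun i => z i ≠ z' i).card
  have hle : d ≤ n := by simpa using Finset.card_le_univ (Finset.univ.filter fun i => z i ≠ z' i)
  have hk' : (2 : ℝ) ≤ k := by exact_mod_cast hk
  have hk0 : (0 : ℝ) < k := by linarith
  have h := coeff_trinomial_pow_sq_le (a := (k : ℝ) - 2) (by linarith) d
  rw [sub_add_cancel] at h
  refine le_of_mul_le_mul_right ?_ hk0
  have e : (k : ℝ) ^ (2 * n) * k = (k ^ (n - d)) ^ 2 * k ^ (2 * d + 1) := by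
    rw [← pow_mul, ← pow_add, ← pow_succ]; congr 1; omega
  rw [e]
  refine le_trans (le_of_eq ?_) (mul_le_mul_of_nonneg_left h (by positivity))
  field_simp

theorem one_add_log_sq_le {t : ℝ} (ht : 1 ≤ t) : (1 + Real.log t) ^ 2 ≤ 4 * t := by
  have h0 : 0 ≤ Real.log t := Real.log_nonneg ht
  have h1 : Real.log √t ≤ √t - 1 := Real.log_le_sub_one_of_pos (Real.sqrt_pos.mpr (by linarith))
  rw [Real.log_sqrt (by linarith)] at h1
  have h2 : √t ^ 2 = t := Real.sq_sqrt (by linarith)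
  nlinarith [Real.sqrt_nonneg t]

/-- The number of queries suffices for the union bound over pairs at Hamming distance `d`. -/
theorem log_union_bound {n k d N : ℝ} (hk : 2 ≤ k) (hkn : k ≤ n) (hd : 1 ≤ d) (hdn : d ≤ n)
    (hN : 200 * n * Real.log k / max (Real.log (n / k)) 1 ≤ N) :
    d * (1 + Real.log (n / d) + 2 * Real.log k) + 2 * Real.log n ≤
      N / 2 * Real.log (1 + d / k) := by
  have hk0 : 0 < k := by linarith
  have hn0 : 0 < n := by linarith
  have hd0 : 0 < d := by linarith
  have hlog2 : 1 / 2 ≤ Real.log 2 := by linarith [Real.log_two_gt_d9]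
  have hlk : 1 / 2 ≤ Real.log k := hlog2.trans (Real.log_le_log two_pos hk)
  have hT : 0 ≤ Real.log (n / d) := Real.log_nonneg ((one_le_div hd0).mpr hdn)
  have hs : 0 ≤ Real.log (n / k) := Real.log_nonneg ((one_le_div hk0).mpr hkn)
  have hTs := one_add_log_sq_le ((one_le_div hd0).mpr hdn)
  have hss := one_add_log_sq_le ((one_le_div hk0).mpr hkn)
  have eT : Real.log (n / d) = Real.log n - Real.log d := Real.log_div hn0.ne' hd0.ne'
  have es : Real.log (n / k) = Real.log n - Real.log k := Real.log_div hn0.ne' hk0.ne'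
  have hld : Real.log d ≤ d - 1 := Real.log_le_sub_one_of_pos hd0
  have hld0 : 0 ≤ Real.log d := Real.log_nonneg hd
  set T := Real.log (n / d)
  set s := Real.log (n / k)
  set V := Real.log (1 + d / k) with hV
  set K := Real.log k
  set R := max s 1 with hR
  have hR0 : 0 < R := lt_of_lt_of_le one_pos (le_max_right _ _)
  rw [div_le_iff₀ hR0] at hN
  have hN0 : 0 < N := by
    by_contra! h
    nlinarith [mul_pos hn0 (show 0 < K by linarith), mul_nonneg (neg_nonneg.mpr h) hR0.le]
  rcases le_or_gt k d with hkd | hkd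
  · have hu : 1 ≤ d / k := (one_le_div hk0).mpr hkd
    have hV2 : 1 / 2 ≤ V := hlog2.trans (Real.log_le_log two_pos (by linarith))
    have hVU : Real.log d - K ≤ V := by
      rw [← Real.log_div hd0.ne' hk0.ne']
      exact Real.log_le_log (by positivity) (by linarith)
    have hRV : R ≤ 2 * V * (1 + T) := by
      refine max_le ?_ ?_ <;> nlinarith [mul_nonneg hT (sub_nonneg.mpr hV2)]
    have hNV : 100 * n * K ≤ N * V * (1 + T) := by
      linarith [mul_le_mul_of_nonneg_left hRV hN0.le]
    have ht : (1 + T) ^ 2 * d ≤ 4 * n := by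
      calc _ ≤ 4 * (n / d) * d := by gcongr
        _ = _ := by field_simp
    have hmain : d * (1 + T + 2 * K) + 2 * Real.log n ≤ d * ((1 + T) * (8 * K)) := by
      have h1 : 2 * Real.log n ≤ d * (2 * T + 2) := by
        nlinarith [mul_nonneg (sub_nonneg.mpr hd) hT]
      have h2 : 3 + 3 * T + 2 * K ≤ (1 + T) * (8 * K) := by
        nlinarith [mul_nonneg hT (sub_nonneg.mpr hlk)]
      linarith [mul_le_mul_of_nonneg_left h2 hd0.le]
    refine hmain.trans (le_of_mul_le_mul_right ?_ (show 0 < 1 + T by linarith))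
    have : 8 * K * ((1 + T) ^ 2 * d) ≤ 8 * K * (4 * n) := by gcongr
    nlinarith [mul_pos hn0 (show 0 < K by linarith)]
  · have hu : d / k ≤ 1 := (div_le_one hk0).mpr hkd.le
    have hu0 : 0 < d / k := by positivity
    have hVu : d / k / 2 ≤ V := by
      refine le_trans ?_ (Real.one_sub_inv_le_log_of_pos (show 0 < 1 + d / k by linarith))
      have : 1 - (1 + d / k)⁻¹ = d / k / (1 + d / k) := by field_simp; ring
      rw [this]
      gcongr
      linarith
    have hRs : R ≤ 1 + s := max_le (by linarith) (by linarith)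
    have hNs : 200 * n * K ≤ N * (1 + s) :=
      hN.trans (mul_le_mul_of_nonneg_left hRs hN0.le)
    have hmain : d * (1 + T + 2 * K) + 2 * Real.log n ≤ d * ((1 + s) * (11 * K)) := by
      have h1 : 2 * Real.log n ≤ d * (2 * (s + K)) := by
        nlinarith [mul_nonneg (sub_nonneg.mpr hd) (show 0 ≤ s + K by linarith)]
      have h2 : 1 + 3 * s + 5 * K ≤ (1 + s) * (11 * K) := by
        nlinarith [mul_nonneg hs (sub_nonneg.mpr hlk)]
      have h3 : T ≤ s + K := by linarith
      linarith [mul_le_mul_of_nonneg_left h2 hd0.le, mul_le_mul_of_nonneg_left h3 hd0.le]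
    have h4 : d * ((1 + s) * (11 * K)) ≤ N / 2 * (d / k / 2) := by
      refine le_of_mul_le_mul_right ?_ (show 0 < 1 + s by linarith)
      calc d * ((1 + s) * (11 * K)) * (1 + s) = 11 * d * K * (1 + s) ^ 2 := by ring
        _ ≤ 11 * d * K * (4 * (n / k)) := by gcongr
        _ = 44 * n * K * (d / k) := by field_simp; ring
        _ ≤ 50 * n * K * (d / k) := by
          have : 0 ≤ n * K * (d / k) := by positivity
          linarith
        _ = (200 * n * K) * (d / k / 4) := by ring
        _ ≤ (N * (1 + s)) * (d / k / 4) := by gcongr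
        _ = _ := by ring
    exact hmain.trans (h4.trans (by gcongr))

theorem Nat.choose_le_exp_mul_one_add_log {n d : ℕ} (hd : 1 ≤ d) (hn : 1 ≤ n) :
    (n.choose d : ℝ) ≤ Real.exp (d * (1 + Real.log (n / d))) := by
  have hd0 : (0 : ℝ) < d := by exact_mod_cast hd
  have hn0 : (0 : ℝ) < n := by exact_mod_cast hn
  have h := Real.pow_div_factorial_le_exp (d : ℝ) hd0.le d
  calc (n.choose d : ℝ) ≤ (n : ℝ) ^ d / d.factorial := Nat.choose_le_pow_div d n
    _ = (n / d : ℝ) ^ d * ((d : ℝ) ^ d / d.factorial) := by rw [div_pow]; field_simp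
    _ ≤ (n / d : ℝ) ^ d * Real.exp d := by gcongr
    _ = Real.exp (Real.log (n / d)) ^ d * Real.exp d := by rw [Real.exp_log (by positivity)]
    _ = _ := by rw [← Real.exp_nat_mul, ← Real.exp_add]; ring_nf

theorem card_mmEq_eq_le_exp {n k : ℕ} (hk : 2 ≤ k) (z z' : Fin n → Fin k) :
    ((Finset.univ.filter fun x : Fin n → Fin k => mmEq z x = mmEq z' x).card : ℝ) ≤
      k ^ n * Real.exp (-(Real.log
        (1 + ((Finset.univ.filter fun i => z i ≠ z' i).card : ℝ) / k) / 2)) := by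
  have h := card_mmEq_eq_sq_le hk z z'
  have hpos : (0 : ℝ) < 1 + (Finset.univ.filter fun i => z i ≠ z' i).card / k := by positivity
  refine le_of_sq_le_sq ?_ (by positivity)
  rw [mul_pow, ← pow_mul, mul_comm n 2, ← Real.exp_nat_mul]
  refine ((le_div_iff₀ hpos).mpr h).trans (le_of_eq ?_)
  rw [div_eq_mul_inv, show ∀ y : ℝ, ((2 : ℕ) : ℝ) * -(y / 2) = -y from fun y => by push_cast; ring,
    Real.exp_neg, Real.exp_log hpos]

theorem mmEq_sub_mmEq {n k : ℕ} (z z' x : Fin n → Fin k) :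
    (mmEq z x : ℤ) - mmEq z' x =
      ∑ i, ((if z i = x i then 1 else 0) - (if z' i = x i then 1 else 0)) := by
  simp [mmEq, Finset.sum_sub_distrib]

theorem mmEq_eq_mmEq_normalize {n k : ℕ} (c : Fin k) {z z' x : Fin n → Fin k}
    (h : mmEq z x = mmEq z' x) :
    mmEq (fun i => if z i = z' i then c else z i) x =
      mmEq (fun i => if z i = z' i then c else z' i) x := by
  rw [← Int.natCast_inj, ← sub_eq_zero, mmEq_sub_mmEq] at h ⊢
  refine Eq.trans (Finset.sum_congr rfl fun i _ => ?_) h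
  by_cases hi : z i = z' i <;> simp [hi]

/-- Union bound over the pairs of codes that agree with a fixed colour `c` wherever they coincide. -/
theorem card_not_injective_le {n k : ℕ} (N : ℕ) (c : Fin k) (f : ℕ → ℝ)
    (hf : ∀ z z' : Fin n → Fin k, z ≠ z' →
      ((Finset.univ.filter fun x : Fin n → Fin k => mmEq z x = mmEq z' x).card : ℝ) ^ N ≤
        f (Finset.univ.filter fun i => z i ≠ z' i).card)
    (hfn : ∀ d, 0 ≤ f d) :
    ((Finset.univ.filter fun x : Fin N → (Fin n → Fin k) =>
      ¬ Function.Injective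
        (fun z : Fin n → Fin k => fun j : Fin N => mmEq z (x j))).card : ℝ) ≤
      ∑ d ∈ Finset.range n, (n.choose (d + 1) : ℝ) * ((k : ℝ) ^ (2 * (d + 1)) * f (d + 1)) := by
  classical
  set P : Finset (Fin n) → Finset (Fin n → Fin k) := fun S =>
    Fintype.piFinset fun i => if i ∈ S then Finset.univ else {c} with hP
  have hPcard : ∀ S, (P S).card = k ^ S.card := fun S => by
    simp only [hP, Fintype.card_piFinset, apply_ite Finset.card, Finset.card_univ,
      Fintype.card_fin, Finset.card_singleton]
    simp
  set Q : Finset (Fin n) → Finset ((Fin n → Fin k) × (Fin n → Fin k)) := fun S =>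
    (P S ×ˢ P S).filter fun p => p.1 ≠ p.2 ∧ (Finset.univ.filter fun i => p.1 i ≠ p.2 i) = S with hQ
  set g : ℕ → ℝ := fun d => if d = 0 then 0 else (k : ℝ) ^ (2 * d) * f d with hg
  have hcover : (Finset.univ.filter fun x : Fin N → (Fin n → Fin k) =>
      ¬ Function.Injective (fun z : Fin n → Fin k => fun j : Fin N => mmEq z (x j))) ⊆
      (Finset.univ : Finset (Fin n)).powerset.biUnion fun S => (Q S).biUnion fun p =>
        Fintype.piFinset fun _ : Fin N =>
          Finset.univ.filter fun x : Fin n → Fin k => mmEq p.1 x = mmEq p.2 x := by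
    intro x hx
    rw [Finset.mem_filter, Function.not_injective_iff] at hx
    obtain ⟨-, z, z', hzz, hne⟩ := hx
    rw [Finset.mem_biUnion]
    refine ⟨Finset.univ.filter fun i => z i ≠ z' i, by simp, ?_⟩
    rw [Finset.mem_biUnion]
    refine ⟨(fun i => if z i = z' i then c else z i, fun i => if z i = z' i then c else z' i),
      ?_, ?_⟩
    · simp only [hQ, hP, Finset.mem_filter, Finset.mem_product, Fintype.mem_piFinset]
      refine ⟨⟨fun i => ?_, fun i => ?_⟩, fun h => hne ?_, ?_⟩
      · by_cases hi : z i = z' i <;> simp [hi]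
      · by_cases hi : z i = z' i <;> simp [hi]
      · funext i
        have := congrFun h i
        by_cases hi : z i = z' i
        · exact hi
        · simp [hi] at this
      · ext i
        by_cases hi : z i = z' i <;> simp [hi]
    · rw [Fintype.mem_piFinset]
      intro j
      rw [Finset.mem_filter]
      exact ⟨Finset.mem_univ _, mmEq_eq_mmEq_normalize c (congrFun hzz j)⟩
  have hQsum : ∀ S, ∑ p ∈ Q S, ((Fintype.piFinset fun _ : Fin N =>
      Finset.univ.filter fun x : Fin n → Fin k => mmEq p.1 x = mmEq p.2 x).card : ℝ) ≤
      g S.card := fun S => by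
    by_cases hS : S.card = 0
    · have hQe : Q S = ∅ := by
        refine Finset.filter_eq_empty_iff.mpr ?_
        rintro p - ⟨hne, hp⟩
        rw [Finset.card_eq_zero.mp hS, Finset.filter_eq_empty_iff] at hp
        exact hne (funext fun i => not_not.mp (hp (Finset.mem_univ i)))
      simp [hQe, hg, hS]
    · have hle : ∀ p ∈ Q S, ((Fintype.piFinset fun _ : Fin N =>
          Finset.univ.filter fun x : Fin n → Fin k => mmEq p.1 x = mmEq p.2 x).card : ℝ) ≤
          f S.card := fun p hp => by
        obtain ⟨-, hne, hpS⟩ := Finset.mem_filter.mp hp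
        have := hf p.1 p.2 hne
        rw [hpS] at this
        simpa using this
      refine (Finset.sum_le_card_nsmul _ _ _ hle).trans ?_
      simp only [hg, if_neg hS, nsmul_eq_mul]
      refine mul_le_mul_of_nonneg_right ?_ (hfn _)
      have : (Q S).card ≤ k ^ (2 * S.card) := by
        refine (Finset.card_filter_le _ _).trans (le_of_eq ?_)
        rw [Finset.card_product, hPcard, two_mul, pow_add]
      exact_mod_cast this
  have h1 := (Finset.card_le_card hcover).trans (Finset.card_biUnion_le.trans
    (Finset.sum_le_sum fun S _ => Finset.card_biUnion_le))
  refine le_trans (Nat.cast_le.mpr h1) ?_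
  push_cast
  refine (Finset.sum_le_sum fun S _ => hQsum S).trans ?_
  rw [Finset.sum_powerset_apply_card g, Finset.card_univ, Fintype.card_fin,
    Finset.sum_range_succ']
  simp [hg]

/-- With `N := ⌈C · n · log k / max{log(n/k), 1}⌉`, the number of `N`-tuples of
queries whose answer map is not injective is at most `k^{nN}/n`; i.e., `N`
uniformly random queries identify every secret code with probability `≥ 1 − 1/n`. -/
theorem stmt_3 :
    ∃ (n₀ : ℕ) (C : ℝ), 0 < C ∧
      ∀ n k : ℕ, n₀ ≤ n → 2 ≤ k → k ≤ n →
        ∀ N : ℕ,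
          N = ⌈C * n * Real.log k / max (Real.log ((n : ℝ) / k)) 1⌉₊ →
          ((Finset.univ.filter fun x : Fin N → (Fin n → Fin k) =>
              ¬ Function.Injective
                (fun z : Fin n → Fin k => fun j : Fin N => mmEq z (x j))).card : ℝ) ≤
            (k : ℝ) ^ (n * N) / n := by
  refine ⟨0, 200, by norm_num, fun n k _ hk hkn N hN => ?_⟩
  have hN' : 200 * n * Real.log k / max (Real.log ((n : ℝ) / k)) 1 ≤ N := hN ▸ Nat.le_ceil _
  have hn0 : (0 : ℝ) < n := by exact_mod_cast (show 0 < n by omega)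
  have hk0 : (0 : ℝ) < k := by exact_mod_cast (show 0 < k by omega)
  set f : ℕ → ℝ := fun d => k ^ (n * N) * Real.exp (-(N / 2 * Real.log (1 + (d : ℝ) / k))) with hf
  have hfn : ∀ d, 0 ≤ f d := fun d => by positivity
  refine (card_not_injective_le N ⟨0, by omega⟩ f (fun z z' _ => ?_) hfn).trans ?_
  · refine (pow_le_pow_left₀ (Nat.cast_nonneg _) (card_mmEq_eq_le_exp hk z z') N).trans
      (le_of_eq ?_)
    rw [mul_pow, ← pow_mul, ← Real.exp_nat_mul]
    simp only [hf]
    congr 2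
    ring
  · have hterm : ∀ d ∈ Finset.range n,
        (n.choose (d + 1) : ℝ) * ((k : ℝ) ^ (2 * (d + 1)) * f (d + 1)) ≤
          k ^ (n * N) / n ^ 2 := fun d hd => by
      have hdn : d + 1 ≤ n := Finset.mem_range.mp hd
      have h := log_union_bound (n := n) (k := k) (d := (d + 1 : ℕ)) (N := N)
        (by exact_mod_cast hk) (by exact_mod_cast hkn) (by simp)
        (by exact_mod_cast hdn) hN'
      have hch := Nat.choose_le_exp_mul_one_add_log (n := n) (d := d + 1) (by omega) (by omega)
      have hkp : (k : ℝ) ^ (2 * (d + 1)) = Real.exp ((2 * (d + 1) : ℕ) * Real.log k) := by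
        rw [Real.exp_nat_mul, Real.exp_log hk0]
      have hnp : ((n : ℝ) ^ 2)⁻¹ = Real.exp (-(2 * Real.log n)) := by
        rw [Real.exp_neg, two_mul, Real.exp_add, Real.exp_log hn0, sq]
      calc _ ≤ Real.exp ((d + 1 : ℕ) * (1 + Real.log (n / (d + 1 : ℕ)))) *
            (Real.exp ((2 * (d + 1) : ℕ) * Real.log k) * f (d + 1)) := by
            rw [hkp]
            exact mul_le_mul_of_nonneg_right hch (mul_nonneg (Real.exp_pos _).le (hfn _))
        _ = k ^ (n * N) * Real.exp ((d + 1 : ℕ) * (1 + Real.log (n / (d + 1 : ℕ))) +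
            (2 * (d + 1) : ℕ) * Real.log k - N / 2 * Real.log (1 + (d + 1 : ℕ) / k)) := by
            rw [sub_eq_add_neg, Real.exp_add, Real.exp_add]
            ring
        _ ≤ k ^ (n * N) * Real.exp (-(2 * Real.log n)) := by
            gcongr
            push_cast at h ⊢
            linarith
        _ = _ := by rw [← hnp, div_eq_mul_inv]
    refine (Finset.sum_le_card_nsmul _ _ _ hterm).trans (le_of_eq ?_)
    rw [Finset.card_range, nsmul_eq_mul]
    field_simp
end
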